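/- For every 0 < r ≤ 1 and every z ∈ ℝ, the function h(θ) = (1/2)(θ − z)² + r·log(1 + |θ|) is both quasi-convex and hemivariate on ℝ. -/

import Mathlib

/-- `f : ℝ → ℝ` is quasi-convex if `f(x + λd) ≤ max {f(x), f(x + d)}` for all `x, d`
and `λ ∈ [0, 1]`. -/
def QuasiConvexFn (f : ℝ → ℝ) : Prop :=
  ∀ x d : ℝ, ∀ l ∈ Set.Icc (0 : ℝ) 1, f (x + l * d) ≤ max (f x) (f (x + d))

/-- `f : ℝ → ℝ` is hemivariate if it is not constant on any nondegenerate interval. -/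
def Hemivariate (f : ℝ → ℝ) : Prop :=
  ∀ a b : ℝ, a < b → ¬ ∃ c : ℝ, ∀ x ∈ Set.Icc a b, f x = c

theorem StrictConvexOn.comp_abs {g : ℝ → ℝ} (hg : StrictConvexOn ℝ (Set.Ici 0) g)
    (hmono : StrictMonoOn g (Set.Ici 0)) : StrictConvexOn ℝ Set.univ (fun x => g |x|) := by
  refine ⟨convex_univ, fun x _ y _ hxy a b ha hb hab => ?_⟩
  have hx : |x| ∈ Set.Ici (0 : ℝ) := abs_nonneg x
  have hy : |y| ∈ Set.Ici (0 : ℝ) := abs_nonneg y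
  have hmem : a * |x| + b * |y| ∈ Set.Ici (0 : ℝ) := by
    simp only [Set.mem_Ici]; positivity
  simp only [smul_eq_mul]
  by_cases h : |x| = |y|
  · have hyx : y = -x := by
      rcases abs_eq_abs.mp h with h' | h'
      · exact absurd h' hxy
      · linarith
    subst hyx
    have hx0 : x ≠ 0 := by rintro rfl; simp at hxy
    have hlt : |a * x + b * -x| < |x| := by
      have : a * x + b * -x = (a - b) * x := by ring
      rw [this, abs_mul]
      have : |a - b| < 1 := abs_lt.mpr ⟨by linarith, by linarith⟩
      nlinarith [abs_pos.mpr hx0]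
    calc g |a * x + b * -x| < g |x| := hmono (Set.mem_Ici.mpr (abs_nonneg _)) hx hlt
      _ = a * g |x| + b * g |-x| := by rw [abs_neg, ← add_mul, hab, one_mul]
  · have hle : |a * x + b * y| ≤ a * |x| + b * |y| := by
      simpa only [abs_mul, abs_of_pos ha, abs_of_pos hb] using abs_add_le (a * x) (b * y)
    exact (hmono.monotoneOn (Set.mem_Ici.mpr (abs_nonneg _)) hmem hle).trans_lt
      (hg.2 hx hy h ha hb hab)

theorem StrictConvexOn.quasiConvexFn {f : ℝ → ℝ} (hf : StrictConvexOn ℝ Set.univ f) :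
    QuasiConvexFn f := by
  intro x d l hl
  have h := hf.convexOn.le_max_of_mem_segment (Set.mem_univ x) (Set.mem_univ (x + d))
    (z := x + l * d) ⟨1 - l, l, by linarith [hl.2], hl.1, by ring, by simp only [smul_eq_mul]; ring⟩
  exact h

theorem StrictConvexOn.hemivariate {f : ℝ → ℝ} (hf : StrictConvexOn ℝ Set.univ f) :
    Hemivariate f := by
  rintro a b hab ⟨c, hc⟩
  have h := hf.2 (Set.mem_univ a) (Set.mem_univ b) hab.ne
    (by norm_num : (0 : ℝ) < 1 / 2) (by norm_num : (0 : ℝ) < 1 / 2) (by norm_num)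
  simp only [smul_eq_mul] at h
  rw [hc a ⟨le_rfl, hab.le⟩, hc b ⟨hab.le, le_rfl⟩,
    hc (1 / 2 * a + 1 / 2 * b) ⟨by linarith, by linarith⟩] at h
  linarith

theorem strictMonoOn_half_sq_add_log {r : ℝ} (hr0 : 0 < r) :
    StrictMonoOn (fun t : ℝ => (1 / 2) * t ^ 2 + r * Real.log (1 + t)) (Set.Ici 0) := by
  intro s hs t _ hst
  simp only [Set.mem_Ici] at hs
  have hlog : Real.log (1 + s) < Real.log (1 + t) :=
    Real.log_lt_log (by linarith) (by linarith)
  have := mul_lt_mul_of_pos_left hlog hr0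
  dsimp only
  nlinarith

theorem strictConvexOn_half_sq_add_log {r : ℝ} (hr0 : 0 < r) (hr1 : r ≤ 1) :
    StrictConvexOn ℝ (Set.Ici 0) (fun t : ℝ => (1 / 2) * t ^ 2 + r * Real.log (1 + t)) := by
  have hderiv : ∀ t : ℝ, 0 ≤ t →
      HasDerivAt (fun t : ℝ => (1 / 2) * t ^ 2 + r * Real.log (1 + t)) (t + r / (1 + t)) t := by
    intro t ht
    have h1 : HasDerivAt (fun t : ℝ => 1 + t) 1 t := (hasDerivAt_id t).const_add 1
    have h2 := (h1.log (by linarith : 1 + t ≠ 0)).const_mul r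
    have h3 := ((hasDerivAt_pow 2 t).const_mul (1 / 2 : ℝ)).add h2
    refine h3.congr_deriv ?_
    push_cast
    ring
  refine StrictMonoOn.strictConvexOn_of_deriv (convex_Ici 0)
    (fun t ht => (hderiv t ht).continuousAt.continuousWithinAt) ?_
  rw [interior_Ici]
  intro s hs t ht hst
  simp only [Set.mem_Ioi] at hs ht
  rw [(hderiv s hs.le).deriv, (hderiv t ht.le).deriv]
  have hs1 : 0 < 1 + s := by linarith
  have ht1 : 0 < 1 + t := by linarith
  have hdiff : r / (1 + s) - r / (1 + t) = r * (t - s) / ((1 + s) * (1 + t)) := by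
    field_simp
    ring
  have hlt : r * (t - s) / ((1 + s) * (1 + t)) < t - s := by
    rw [div_lt_iff₀ (by positivity)]
    have hprod : r < (1 + s) * (1 + t) := by nlinarith [mul_pos hs ht]
    nlinarith [mul_lt_mul_of_pos_right hprod (sub_pos.mpr hst)]
  linarith

theorem strictConvexOn_half_sq_sub_add_log_abs {r : ℝ} (z : ℝ) (hr0 : 0 < r) (hr1 : r ≤ 1) :
    StrictConvexOn ℝ Set.univ
      (fun θ : ℝ => (1 / 2) * (θ - z) ^ 2 + r * Real.log (1 + |θ|)) := by
  have haffine : ConvexOn ℝ Set.univ (fun θ : ℝ => -z * θ + (1 / 2) * z ^ 2) := by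
    refine ⟨convex_univ, fun x _ y _ a b _ _ hab => le_of_eq ?_⟩
    simp only [smul_eq_mul]
    linear_combination -(1 / 2) * z ^ 2 * hab
  have heq : (fun θ : ℝ => (1 / 2) * (θ - z) ^ 2 + r * Real.log (1 + |θ|)) =
      (fun θ : ℝ => (1 / 2) * |θ| ^ 2 + r * Real.log (1 + |θ|)) +
        fun θ : ℝ => -z * θ + (1 / 2) * z ^ 2 := by
    funext θ
    simp only [Pi.add_apply, sq_abs]
    ring
  rw [heq]
  exact ((strictConvexOn_half_sq_add_log hr0 hr1).comp_abs
    (strictMonoOn_half_sq_add_log hr0)).add_convexOn haffine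

/-- For every `0 < r ≤ 1` and `z ∈ ℝ`, `h(θ) = (1/2)(θ − z)² + r·log(1 + |θ|)` is both
quasi-convex and hemivariate on ℝ. -/
theorem stmt_11 (r z : ℝ) (hr0 : 0 < r) (hr1 : r ≤ 1) :
    QuasiConvexFn (fun θ => (1 / 2) * (θ - z) ^ 2 + r * Real.log (1 + |θ|)) ∧
    Hemivariate (fun θ => (1 / 2) * (θ - z) ^ 2 + r * Real.log (1 + |θ|)) :=
  have h := strictConvexOn_half_sq_sub_add_log_abs z hr0 hr1
  ⟨h.quasiConvexFn, h.hemivariate⟩
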